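/- Let H be a complex Hilbert space, X ⊆ B(H) a linear subspace, e ∈ X with ‖e‖ = 1, D ⊆ X × X a domain, and m : D → X a non-degenerate partial product. For A ∈ M_n(X) define the factorization quantity ‖A‖_n^m := inf{ ‖X^{(1)}‖ ⋯ ‖X^{(N)}‖ : (X^{(1)}, …, X^{(N)}) is a permissible tuple of matrices over X with A = X^{(1)} ⊙_m ⋯ ⊙_m X^{(N)} }. Then the family {‖·‖_n^m} is an L∞-matrix seminorm on X: ‖α A β‖_k^m ≤ ‖α‖ ‖β‖ ‖A‖_n^m for scalar matrices α ∈ M_{k,n}(ℂ), β ∈ M_{n,k}(ℂ), and ‖A ⊕ B‖_{n+k}^m = max(‖A‖_n^m, ‖B‖_k^m). Moreover, if there exists an injective linear map i : X → B(K) with i(e) = I_K that is completely contractive with respect to the matrix norms inherited from B(H) and satisfies i(m(a,b)) = i(a)i(b) for all (a,b) ∈ D, then each ‖·‖_n^m is a norm (‖A‖_n^m > 0 for A ≠ 0), and i satisfies ‖i^{(n)}(A)‖ ≤ ‖A‖_n^m for all n and A ∈ M_n(X). -/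

import Mathlib

noncomputable section

open scoped BigOperators

/-- A partial product on a complex vector space `V` with distinguished element `e`:
a domain `D ⊆ V × V` together with subspaces `R x` and `L x` (each containing `e`) witnessing
the domain conditions, and a (partially meaningful) product `m` which is unital and bilinear
where defined. -/
structure PartialProduct (V : Type*) [AddCommGroup V] [Module ℂ V] (e : V) where
  /-- The domain of the partial product. -/
  D : Set (V × V)
  /-- The partial product (as a total function; only its values on `D` are meaningful). -/
  m : V → V → V
  /-- For each `x`, a unital subspace `R x` with `ℂx × R x ⊆ D`. -/
  R : V → Submodule ℂ V
  /-- For each `y`, a unital subspace `L y` with `L y × ℂy ⊆ D`. -/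
  L : V → Submodule ℂ V
  unit_left : ∀ (c : ℂ) (x : V), (c • e, x) ∈ D
  unit_right : ∀ (c : ℂ) (x : V), (x, c • e) ∈ D
  e_mem_R : ∀ x : V, e ∈ R x
  e_mem_L : ∀ y : V, e ∈ L y
  mem_right : ∀ (x : V) (c : ℂ) (r : V), r ∈ R x → (c • x, r) ∈ D
  mem_left : ∀ (y : V) (c : ℂ) (l : V), l ∈ L y → (l, c • y) ∈ D
  m_unital_left : ∀ x : V, m e x = x
  m_unital_right : ∀ x : V, m x e = x
  m_add_left : ∀ (x y z : V) (c : ℂ), y ∈ L x → z ∈ L x →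
    m (y + c • z) x = m y x + c • m z x
  m_add_right : ∀ (x y z : V) (c : ℂ), y ∈ R x → z ∈ R x →
    m x (y + c • z) = m x y + c • m x z

/-- A pair of matrices over `V` is a valid pair for a partial product when all the relevant
entry pairs lie in the domain. -/
def PartialProduct.ValidPair {V : Type*} [AddCommGroup V] [Module ℂ V] {e : V}
    (P : PartialProduct V e) {n k l : ℕ}
    (A : Matrix (Fin n) (Fin k) V) (B : Matrix (Fin k) (Fin l) V) : Prop :=
  ∀ (i : Fin n) (r : Fin k) (j : Fin l), (A i r, B r j) ∈ P.D

/-- The matrix product `A ⊙_m B` of a valid pair. -/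
def PartialProduct.odot {V : Type*} [AddCommGroup V] [Module ℂ V] {e : V}
    (P : PartialProduct V e) {n k l : ℕ}
    (A : Matrix (Fin n) (Fin k) V) (B : Matrix (Fin k) (Fin l) V) :
    Matrix (Fin n) (Fin l) V :=
  Matrix.of fun i j => ∑ r, P.m (A i r) (B r j)

/-- The relation on the free (tensor) algebra `F(V)` identifying `a · b` with `m(a, b)` for
`(a, b) ∈ D`. -/
def PartialProduct.rel {V : Type*} [AddCommGroup V] [Module ℂ V] {e : V}
    (P : PartialProduct V e) :
    TensorAlgebra ℂ V → TensorAlgebra ℂ V → Prop := fun p q =>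
  ∃ a b : V, (a, b) ∈ P.D ∧
    p = TensorAlgebra.ι ℂ a * TensorAlgebra.ι ℂ b ∧ q = TensorAlgebra.ι ℂ (P.m a b)

/-- The algebra `F_m(V) = F(V)/J_m`. -/
abbrev PartialProduct.FreeAlg {V : Type*} [AddCommGroup V] [Module ℂ V] {e : V}
    (P : PartialProduct V e) : Type _ := RingQuot P.rel

/-- The canonical map `V → F_m(V)`, `v ↦ v + J_m`. -/
noncomputable def PartialProduct.emb {V : Type*} [AddCommGroup V] [Module ℂ V] {e : V}
    (P : PartialProduct V e) : V → P.FreeAlg :=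
  fun v => RingQuot.mkAlgHom ℂ P.rel (TensorAlgebra.ι ℂ v)

/-- A chain (tuple) of matrices over `V` with compatible dimensions, starting with `n` rows
and ending with `k` columns. -/
structure MatChain (V : Type*) (n k : ℕ) where
  /-- the number of matrices in the chain -/
  len : ℕ
  /-- the sequence of dimensions -/
  dims : Fin (len + 1) → ℕ
  dim_first : dims 0 = n
  dim_last : dims (Fin.last len) = k
  /-- the matrices: the `i`-th matrix has size `dims i × dims (i+1)` -/
  mats : ∀ i : Fin len, Matrix (Fin (dims i.castSucc)) (Fin (dims i.succ)) V

/-- The product of a chain of matrices over `V`, computed in a semiring `R` via a map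
`f : V → R`: the usual iterated matrix product `f(X⁽¹⁾) f(X⁽²⁾) ⋯ f(X⁽ᴺ⁾)`. -/
noncomputable def MatChain.prodIn {V : Type*} {n k : ℕ} (C : MatChain V n k)
    {R : Type*} [Semiring R] (f : V → R) : Matrix (Fin n) (Fin k) R :=
  Matrix.of fun i j =>
    ∑ p ∈ Finset.univ.filter
        (fun p : (∀ t : Fin (C.len + 1), Fin (C.dims t)) =>
          p 0 = Fin.cast C.dim_first.symm i ∧ p (Fin.last C.len) = Fin.cast C.dim_last.symm j),
      (List.ofFn fun t : Fin C.len => f (C.mats t (p t.castSucc) (p t.succ))).prod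

variable {H : Type} [NormedAddCommGroup H] [InnerProductSpace ℂ H] [CompleteSpace H]

/-- A matrix over `B(H)` viewed as a bounded operator between the `ℓ²`-direct sums `H^κ → H^ι`. -/
noncomputable def opMatCLM {ι κ : Type} [Fintype ι] [Fintype κ]
    (A : Matrix ι κ (H →L[ℂ] H)) :
    PiLp 2 (fun _ : κ => H) →L[ℂ] PiLp 2 (fun _ : ι => H) :=
  ((PiLp.continuousLinearEquiv 2 ℂ (fun _ : ι => H)).symm.toContinuousLinearMap) ∘L
    (ContinuousLinearMap.pi fun i => ∑ j, (A i j).comp (ContinuousLinearMap.proj j)) ∘L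
    ((PiLp.continuousLinearEquiv 2 ℂ (fun _ : κ => H)).toContinuousLinearMap)

/-- The operator norm of a matrix over `B(H)`, viewed as an operator `H^κ → H^ι`. -/
noncomputable def opMatNorm {ι κ : Type} [Fintype ι] [Fintype κ]
    (A : Matrix ι κ (H →L[ℂ] H)) : ℝ := ‖opMatCLM A‖

/-- The norm of a matrix over a subspace `X ⊆ B(H)`, computed in `B(H)`. -/
noncomputable def subMatNorm {X : Submodule ℂ (H →L[ℂ] H)} {ι κ : Type} [Fintype ι] [Fintype κ]
    (A : Matrix ι κ ↥X) : ℝ := opMatNorm (A.map (fun v => (v : H →L[ℂ] H)))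

/-- The cost of a chain of matrices over `X ⊆ B(H)`: the product of the norms of its
matrices. -/
noncomputable def chainCost {X : Submodule ℂ (H →L[ℂ] H)} {n k : ℕ}
    (C : MatChain ↥X n k) : ℝ :=
  ∏ t : Fin C.len, subMatNorm (C.mats t)

/-- The factorization seminorm `‖A‖^m`: the infimum of `‖X⁽¹⁾‖ ⋯ ‖X⁽ᴺ⁾‖` over all permissible
factorizations `A = X⁽¹⁾ ⊙_m ⋯ ⊙_m X⁽ᴺ⁾` (chains of matrices over `X` whose iterated product,
computed in `F_m(X)`, equals the image of `A`). -/
noncomputable def factNorm {X : Submodule ℂ (H →L[ℂ] H)} {e : ↥X}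
    (P : PartialProduct ↥X e) {n k : ℕ} (A : Matrix (Fin n) (Fin k) ↥X) : ℝ :=
  sInf { r : ℝ | ∃ C : MatChain ↥X n k, 1 ≤ C.len ∧
    C.prodIn P.emb = A.map P.emb ∧ r = chainCost C }

/-- The operator norm of a rectangular complex scalar matrix, viewed as a linear map
between finite-dimensional Hilbert spaces `ℂ^n → ℂ^m`. -/
noncomputable def cOpNorm {m n : ℕ} (α : Matrix (Fin m) (Fin n) ℂ) : ℝ :=
  ‖LinearMap.toContinuousLinearMap (Matrix.toEuclideanLin α)‖

/-- Left multiplication of a matrix over a complex vector space `V` by a scalar matrix. -/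
def scalarMulMat {V : Type*} [AddCommGroup V] [Module ℂ V] {k n m : ℕ}
    (α : Matrix (Fin k) (Fin n) ℂ) (x : Matrix (Fin n) (Fin m) V) :
    Matrix (Fin k) (Fin m) V :=
  Matrix.of fun i j => ∑ r, α i r • x r j

/-- Right multiplication of a matrix over a complex vector space `V` by a scalar matrix. -/
def matMulScalar {V : Type*} [AddCommGroup V] [Module ℂ V] {n m l : ℕ}
    (x : Matrix (Fin n) (Fin m) V) (β : Matrix (Fin m) (Fin l) ℂ) :
    Matrix (Fin n) (Fin l) V :=
  Matrix.of fun i j => ∑ r, β r j • x i r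

/-- The block-diagonal direct sum `x ⊕ y` of two matrices over `V`. -/
def blockDiagSum {V : Type*} [AddCommGroup V] {n m p q : ℕ}
    (x : Matrix (Fin n) (Fin m) V) (y : Matrix (Fin p) (Fin q) V) :
    Matrix (Fin (n + p)) (Fin (m + q)) V :=
  Matrix.reindex finSumFinEquiv finSumFinEquiv (Matrix.fromBlocks x 0 0 y)

/-- Prepend a matrix to a chain. -/
def MatChain.cons {V : Type*} {n l k : ℕ} (A : Matrix (Fin n) (Fin l) V) :
    MatChain V l k → MatChain V n k
  | ⟨len, dims, h₁, h₂, mats⟩ =>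
    { len := len + 1
      dims := Fin.cons n dims
      dim_first := rfl
      dim_last := h₂
      mats := Fin.cases (motive := fun t : Fin (len + 1) =>
        Matrix (Fin (Fin.cons (α := fun _ => ℕ) n dims t.castSucc))
          (Fin (Fin.cons (α := fun _ => ℕ) n dims t.succ)) V)
        (A.submatrix id (Fin.cast h₁)) mats }

/-- The empty chain. -/
def MatChain.nil (V : Type*) (n : ℕ) : MatChain V n n where
  len := 0
  dims := fun _ => n
  dim_first := rfl
  dim_last := rfl
  mats := fun t => t.elim0

theorem MatChain.prodIn_nil {V R : Type*} [Semiring R] (n : ℕ) (f : V → R) :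
    (MatChain.nil V n).prodIn f = 1 := by
  ext i j
  have key : (MatChain.nil V n).prodIn f i j =
      ∑ p : Fin 1 → Fin n, if p 0 = i ∧ p 0 = j then (1 : R) else 0 :=
    Finset.sum_filter _ _
  rw [key, Fintype.sum_equiv (Equiv.funUnique (Fin 1) (Fin n)) _
    (fun q => if q = i ∧ q = j then (1 : R) else 0)]
  · simp only [Matrix.one_apply, ite_and, Finset.sum_ite_eq', Finset.mem_univ, if_true]
  · intro p
    rfl

theorem MatChain.prodIn_cons {V R : Type*} [Semiring R] {n l k : ℕ}
    (A : Matrix (Fin n) (Fin l) V) (C : MatChain V l k) (f : V → R) :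
    (MatChain.cons A C).prodIn f = A.map f * C.prodIn f := by
  obtain ⟨len, dims, rfl, rfl, mats⟩ := C
  ext i j
  let w (q : ∀ t : Fin (len + 1), Fin (dims t)) : R :=
    (List.ofFn fun t : Fin len => f (mats t (q t.castSucc) (q t.succ))).prod
  have hC (r : Fin (dims 0)) : (MatChain.mk len dims rfl rfl mats).prodIn f r j =
      ∑ q : ∀ t : Fin (len + 1), Fin (dims t),
        if q 0 = r then if q (Fin.last len) = j then w q else 0 else 0 := by
    simp only [← ite_and]
    exact Finset.sum_filter _ _
  have hcons : (MatChain.cons A (MatChain.mk len dims rfl rfl mats)).prodIn f i j =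
      ∑ q : Fin n × (∀ t : Fin (len + 1), Fin (dims t)),
        if q.1 = i then if q.2 (Fin.last len) = j then f (A q.1 (q.2 0)) * w q.2 else 0
          else 0 := by
    simp only [← ite_and]
    refine (Finset.sum_filter _ _).trans (Fintype.sum_equiv (Fin.consEquiv
      (fun t : Fin (len + 1 + 1) => Fin (Fin.cons (α := fun _ => ℕ) n dims t))) _ _ ?_).symm
    intro (q : Fin n × (∀ t : Fin (len + 1), Fin (dims t)))
    refine congrArg (fun z => if q.1 = i ∧ q.2 (Fin.last len) = j then z else 0) ?_
    refine Eq.trans ?_ (congrArg List.prod (List.ofFn_succ (n := len)).symm)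
    exact List.prod_cons.symm
  rw [hcons, Matrix.mul_apply, Fintype.sum_prod_type_right]
  simp only [hC, Finset.mul_sum]
  conv_rhs => rw [Finset.sum_comm]
  refine Finset.sum_congr rfl fun q _ => ?_
  simp [mul_ite]

theorem MatChain.exists_eq_nil {V : Type*} {n k : ℕ} (C : MatChain V n k) (hC : C.len = 0) :
    ∃ h : n = k, C = h ▸ MatChain.nil V n := by
  obtain ⟨len, dims, rfl, rfl, mats⟩ := C
  obtain rfl : len = 0 := hC
  obtain ⟨d, rfl⟩ : ∃ d : ℕ, dims = fun _ => d := ⟨dims 0, by ext t; fin_cases t; rfl⟩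
  refine ⟨rfl, ?_⟩
  simp only [MatChain.nil]
  congr 1
  funext t
  exact t.elim0

theorem MatChain.exists_eq_cons {V : Type*} {n k N : ℕ} (C : MatChain V n k)
    (hC : C.len = N + 1) : ∃ (l : ℕ) (A : Matrix (Fin n) (Fin l) V) (C' : MatChain V l k),
      C'.len = N ∧ C = MatChain.cons A C' := by
  obtain ⟨len, dims, rfl, rfl, mats⟩ := C
  obtain rfl : len = N + 1 := hC
  obtain ⟨n, d, rfl⟩ : ∃ (n : ℕ) (d : Fin (N + 1) → ℕ), dims = Fin.cons n d :=
    ⟨dims 0, Fin.tail dims, (Fin.cons_self_tail dims).symm⟩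
  refine ⟨d 0, mats 0, ⟨N, d, rfl, rfl, fun t => mats t.succ⟩, rfl, ?_⟩
  simp only [MatChain.cons]
  congr 1
  funext t
  cases t using Fin.cases <;> rfl

section OperatorMatrices

variable {E : Type} [NormedAddCommGroup E] [InnerProductSpace ℂ E]

theorem opMatCLM_apply {ι κ : Type} [Fintype ι] [Fintype κ] (A : Matrix ι κ (E →L[ℂ] E))
    (x : PiLp 2 (fun _ : κ => E)) (i : ι) : opMatCLM A x i = ∑ j, A i j (x j) := by
  simp [opMatCLM]

theorem opMatCLM_mul {ι κ μ : Type} [Fintype ι] [Fintype κ] [Fintype μ]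
    (A : Matrix ι κ (E →L[ℂ] E)) (B : Matrix κ μ (E →L[ℂ] E)) :
    opMatCLM (A * B) = opMatCLM A ∘L opMatCLM B := by
  ext x i
  simp only [opMatCLM_apply, ContinuousLinearMap.comp_apply, Matrix.mul_apply, map_sum,
    sum_apply, mul_apply_eq_comp]
  exact Finset.sum_comm

theorem opMatNorm_mul_le {ι κ μ : Type} [Fintype ι] [Fintype κ] [Fintype μ]
    (A : Matrix ι κ (E →L[ℂ] E)) (B : Matrix κ μ (E →L[ℂ] E)) :
    opMatNorm (A * B) ≤ opMatNorm A * opMatNorm B := by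
  rw [opMatNorm, opMatCLM_mul]
  exact ContinuousLinearMap.opNorm_comp_le _ _

theorem opMatNorm_nonneg {ι κ : Type} [Fintype ι] [Fintype κ] (A : Matrix ι κ (E →L[ℂ] E)) :
    0 ≤ opMatNorm A := (opMatCLM A).opNorm_nonneg

theorem opMatNorm_sum_sq_le {ι κ : Type} [Fintype ι] [Fintype κ] (A : Matrix ι κ (E →L[ℂ] E))
    (x : κ → E) : ∑ i, ‖∑ j, A i j (x j)‖ ^ 2 ≤ opMatNorm A ^ 2 * ∑ j, ‖x j‖ ^ 2 := by
  have h := pow_le_pow_left₀ (norm_nonneg _)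
    ((opMatCLM A).le_opNorm (WithLp.toLp 2 x)) 2
  rw [mul_pow, PiLp.norm_sq_eq_of_L2, PiLp.norm_sq_eq_of_L2] at h
  simp only [opMatCLM_apply] at h
  exact h

theorem opMatNorm_le_of_sum_sq_le {ι κ : Type} [Fintype ι] [Fintype κ]
    {A : Matrix ι κ (E →L[ℂ] E)} {c : ℝ} (hc : 0 ≤ c)
    (h : ∀ x : κ → E, ∑ i, ‖∑ j, A i j (x j)‖ ^ 2 ≤ c ^ 2 * ∑ j, ‖x j‖ ^ 2) :
    opMatNorm A ≤ c := by
  refine ContinuousLinearMap.opNorm_le_bound _ hc fun x => ?_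
  refine le_of_sq_le_sq ?_ (mul_nonneg hc (norm_nonneg _))
  rw [mul_pow, PiLp.norm_sq_eq_of_L2, PiLp.norm_sq_eq_of_L2]
  simpa only [opMatCLM_apply] using h x

theorem opMatNorm_smul_le {ι κ : Type} [Fintype ι] [Fintype κ] (c : ℂ)
    (A : Matrix ι κ (E →L[ℂ] E)) : opMatNorm (c • A) ≤ ‖c‖ * opMatNorm A := by
  refine opMatNorm_le_of_sum_sq_le (mul_nonneg (norm_nonneg _) (opMatNorm_nonneg A)) fun x => ?_
  have := mul_le_mul_of_nonneg_left (opMatNorm_sum_sq_le A x) (sq_nonneg ‖c‖)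
  simpa only [Matrix.smul_apply, smul_apply, ← Finset.smul_sum, norm_smul, mul_pow,
    ← Finset.mul_sum, mul_assoc] using this

theorem opMatNorm_pos {ι κ : Type} [Fintype ι] [Fintype κ] {A : Matrix ι κ (E →L[ℂ] E)}
    (hA : A ≠ 0) : 0 < opMatNorm A := by
  classical
  refine (opMatNorm_nonneg A).lt_of_ne' fun h => hA (Matrix.ext fun i j =>
    ContinuousLinearMap.ext fun x => ?_)
  have hsum := opMatNorm_sum_sq_le A fun l => if l = j then x else 0
  rw [h, zero_pow two_ne_zero, zero_mul] at hsum
  have hi := (Finset.sum_eq_zero_iff_of_nonneg fun i _ => sq_nonneg _).1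
    (hsum.antisymm (Finset.sum_nonneg fun i _ => sq_nonneg _)) i (Finset.mem_univ i)
  simpa [apply_ite] using hi

theorem opMatNorm_one_le {ι : Type} [Fintype ι] [DecidableEq ι] :
    opMatNorm (1 : Matrix ι ι (E →L[ℂ] E)) ≤ 1 := by
  refine opMatNorm_le_of_sum_sq_le zero_le_one fun x => le_of_eq ?_
  simp [Matrix.one_apply, ite_apply, apply_ite]

theorem opMatNorm_blockDiagSum_le_one {n m p q : ℕ} {A : Matrix (Fin n) (Fin m) (E →L[ℂ] E)}
    {B : Matrix (Fin p) (Fin q) (E →L[ℂ] E)} (hA : opMatNorm A ≤ 1) (hB : opMatNorm B ≤ 1) :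
    opMatNorm (blockDiagSum A B) ≤ 1 := by
  refine opMatNorm_le_of_sum_sq_le zero_le_one fun x => ?_
  have h₁ := (opMatNorm_sum_sq_le A fun j => x (Fin.castAdd q j)).trans
    (mul_le_mul_of_nonneg_right (pow_le_one₀ (opMatNorm_nonneg A) hA) (by positivity))
  have h₂ := (opMatNorm_sum_sq_le B fun j => x (Fin.natAdd m j)).trans
    (mul_le_mul_of_nonneg_right (pow_le_one₀ (opMatNorm_nonneg B) hB) (by positivity))
  simp only [blockDiagSum, Matrix.reindex_apply, Fin.sum_univ_add, Matrix.submatrix_apply,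
    finSumFinEquiv_symm_apply_castAdd, finSumFinEquiv_symm_apply_natAdd,
    Matrix.fromBlocks_apply₁₁, Matrix.fromBlocks_apply₁₂, Matrix.fromBlocks_apply₂₁,
    Matrix.fromBlocks_apply₂₂, Matrix.zero_apply, zero_apply,
    Finset.sum_const_zero, add_zero, zero_add]
  linarith

end OperatorMatrices

section ScalarMatrices

theorem cOpNorm_nonneg {m n : ℕ} (α : Matrix (Fin m) (Fin n) ℂ) : 0 ≤ cOpNorm α :=
  norm_nonneg _

theorem cOpNorm_sum_sq_le {m n : ℕ} (α : Matrix (Fin m) (Fin n) ℂ) (x : Fin n → ℂ) :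
    ∑ i, ‖∑ j, α i j * x j‖ ^ 2 ≤ cOpNorm α ^ 2 * ∑ j, ‖x j‖ ^ 2 := by
  have h := pow_le_pow_left₀ (norm_nonneg _)
    ((LinearMap.toContinuousLinearMap (Matrix.toEuclideanLin α)).le_opNorm (WithLp.toLp 2 x)) 2
  rw [mul_pow, EuclideanSpace.norm_sq_eq, EuclideanSpace.norm_sq_eq] at h
  exact h

theorem cOpNorm_le_of_sum_sq_le {m n : ℕ} {α : Matrix (Fin m) (Fin n) ℂ} {c : ℝ} (hc : 0 ≤ c)
    (h : ∀ x : Fin n → ℂ, ∑ i, ‖∑ j, α i j * x j‖ ^ 2 ≤ c ^ 2 * ∑ j, ‖x j‖ ^ 2) :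
    cOpNorm α ≤ c := by
  refine ContinuousLinearMap.opNorm_le_bound _ hc fun x => ?_
  refine le_of_sq_le_sq ?_ (by positivity)
  rw [mul_pow, EuclideanSpace.norm_sq_eq, EuclideanSpace.norm_sq_eq]
  exact h x

/-- The amplification of a scalar matrix to a Hilbert space has the same norm bound. -/
theorem cOpNorm_sum_smul_sq_le {E : Type*} [NormedAddCommGroup E] [InnerProductSpace ℂ E]
    {m n : ℕ} (α : Matrix (Fin m) (Fin n) ℂ) (v : Fin n → E) :
    ∑ i, ‖∑ j, α i j • v j‖ ^ 2 ≤ cOpNorm α ^ 2 * ∑ j, ‖v j‖ ^ 2 := by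
  let S := Submodule.span ℂ (Set.range v)
  let w : Fin n → S := fun j => ⟨v j, Submodule.subset_span ⟨j, rfl⟩⟩
  have : FiniteDimensional ℂ S := FiniteDimensional.span_of_finite ℂ (Set.finite_range v)
  let b := stdOrthonormalBasis ℂ S
  have hw : ∀ i, ‖∑ j, α i j • v j‖ = ‖∑ j, α i j • w j‖ := fun i => by
    have : ∑ j, α i j • v j = ((∑ j, α i j • w j : S) : E) := by simp [w]
    rw [this]
    rfl
  have hv : ∀ j, ‖v j‖ = ‖w j‖ := fun j => rfl
  simp only [hw, hv, ← b.sum_sq_norm_inner_right, inner_sum, inner_smul_right]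
  rw [Finset.sum_comm, Finset.sum_comm (s := (Finset.univ : Finset (Fin n))), Finset.mul_sum]
  exact Finset.sum_le_sum fun c _ => cOpNorm_sum_sq_le α fun j => inner ℂ (b c) (w j)

end ScalarMatrices

section BlockDiagonal

theorem blockDiagSum_map {V W : Type*} [AddCommGroup V] [AddCommGroup W] {n m p q : ℕ}
    (f : V → W) (hf : f 0 = 0) (x : Matrix (Fin n) (Fin m) V) (y : Matrix (Fin p) (Fin q) V) :
    (blockDiagSum x y).map f = blockDiagSum (x.map f) (y.map f) := by
  simp only [blockDiagSum, Matrix.reindex_apply, ← Matrix.submatrix_map, Matrix.fromBlocks_map]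
  congr 2 <;> ext <;> simp [hf]

theorem blockDiagSum_mul {R : Type*} [Ring R] {n m l p q s : ℕ} (A : Matrix (Fin n) (Fin m) R)
    (B : Matrix (Fin p) (Fin q) R) (A' : Matrix (Fin m) (Fin l) R)
    (B' : Matrix (Fin q) (Fin s) R) :
    blockDiagSum A B * blockDiagSum A' B' = blockDiagSum (A * A') (B * B') := by
  simp [blockDiagSum, Matrix.submatrix_mul_equiv, Matrix.fromBlocks_multiply]

theorem blockDiagSum_one {R : Type*} [Ring R] (n p : ℕ) :
    blockDiagSum (1 : Matrix (Fin n) (Fin n) R) (1 : Matrix (Fin p) (Fin p) R) = 1 := by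
  simp [blockDiagSum, Matrix.fromBlocks_one]

/-- The scalar inclusion of the left block, `(1 0)`. -/
def leftProj (n k : ℕ) : Matrix (Fin n) (Fin (n + k)) ℂ :=
  Matrix.of fun i j => if Fin.castAdd k i = j then 1 else 0

/-- The scalar inclusion of the right block, `(0 1)`. -/
def rightProj (n k : ℕ) : Matrix (Fin k) (Fin (n + k)) ℂ :=
  Matrix.of fun i j => if Fin.natAdd n i = j then 1 else 0

theorem castAdd_ne_natAdd {n k : ℕ} (i : Fin n) (j : Fin k) :
    Fin.castAdd k i ≠ Fin.natAdd n j :=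
  Fin.ne_of_val_ne (i.isLt.trans_le (Nat.le_add_right n j)).ne

theorem cOpNorm_leftProj_le (n k : ℕ) : cOpNorm (leftProj n k) ≤ 1 := by
  refine cOpNorm_le_of_sum_sq_le zero_le_one fun x => ?_
  simp only [leftProj, Matrix.of_apply, ite_mul, one_mul, zero_mul, Finset.sum_ite_eq,
    Finset.mem_univ, if_true, Fin.sum_univ_add, one_pow]
  exact le_add_of_nonneg_right (by positivity)

theorem cOpNorm_rightProj_le (n k : ℕ) : cOpNorm (rightProj n k) ≤ 1 := by
  refine cOpNorm_le_of_sum_sq_le zero_le_one fun x => ?_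
  simp only [rightProj, Matrix.of_apply, ite_mul, one_mul, zero_mul, Finset.sum_ite_eq,
    Finset.mem_univ, if_true, Fin.sum_univ_add, one_pow]
  exact le_add_of_nonneg_left (by positivity)

theorem cOpNorm_leftProj_transpose_le (n k : ℕ) : cOpNorm (leftProj n k).transpose ≤ 1 := by
  refine cOpNorm_le_of_sum_sq_le zero_le_one fun x => ?_
  simp [leftProj, Fin.sum_univ_add, castAdd_ne_natAdd]

theorem cOpNorm_rightProj_transpose_le (n k : ℕ) : cOpNorm (rightProj n k).transpose ≤ 1 := by
  refine cOpNorm_le_of_sum_sq_le zero_le_one fun x => ?_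
  simp [rightProj, Fin.sum_univ_add, (castAdd_ne_natAdd _ _).symm]

theorem leftProj_compress_blockDiagSum {V : Type*} [AddCommGroup V] [Module ℂ V] {n k : ℕ}
    (A : Matrix (Fin n) (Fin n) V) (B : Matrix (Fin k) (Fin k) V) :
    matMulScalar (scalarMulMat (leftProj n k) (blockDiagSum A B)) (leftProj n k).transpose =
      A := by
  ext i j
  simp [matMulScalar, scalarMulMat, leftProj, blockDiagSum]

theorem rightProj_compress_blockDiagSum {V : Type*} [AddCommGroup V] [Module ℂ V] {n k : ℕ}
    (A : Matrix (Fin n) (Fin n) V) (B : Matrix (Fin k) (Fin k) V) :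
    matMulScalar (scalarMulMat (rightProj n k) (blockDiagSum A B)) (rightProj n k).transpose =
      B := by
  ext i j
  simp [matMulScalar, scalarMulMat, rightProj, blockDiagSum]

end BlockDiagonal

section PartialProduct

variable {V : Type*} [AddCommGroup V] [Module ℂ V] {e : V} (P : PartialProduct V e)

theorem PartialProduct.emb_smul (c : ℂ) (x : V) : P.emb (c • x) = c • P.emb x := by
  simp [PartialProduct.emb]

theorem PartialProduct.emb_zero : P.emb 0 = 0 := by
  simp [PartialProduct.emb]

theorem PartialProduct.emb_sum {ι : Type*} (s : Finset ι) (f : ι → V) :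
    P.emb (∑ i ∈ s, f i) = ∑ i ∈ s, P.emb (f i) := by
  simp [PartialProduct.emb]

theorem PartialProduct.emb_mul_emb {a b : V} (h : (a, b) ∈ P.D) :
    P.emb a * P.emb b = P.emb (P.m a b) := by
  rw [PartialProduct.emb, PartialProduct.emb, ← map_mul]
  exact RingQuot.mkAlgHom_rel ℂ ⟨a, b, h, rfl, rfl⟩

theorem PartialProduct.emb_unit_mul (x : V) : P.emb e * P.emb x = P.emb x := by
  rw [P.emb_mul_emb (by simpa using P.unit_left 1 x), P.m_unital_left]

theorem PartialProduct.emb_mul_unit (x : V) : P.emb x * P.emb e = P.emb x := by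
  rw [P.emb_mul_emb (by simpa using P.unit_right 1 x), P.m_unital_right]

/-- The matrix `α ⊗ e`. -/
def unitMat {m n : ℕ} (e : V) (α : Matrix (Fin m) (Fin n) ℂ) : Matrix (Fin m) (Fin n) V :=
  α.map fun c => c • e

theorem PartialProduct.unitMat_mul {m n k : ℕ} (α : Matrix (Fin m) (Fin n) ℂ)
    (A : Matrix (Fin n) (Fin k) V) :
    (unitMat e α).map P.emb * A.map P.emb = (scalarMulMat α A).map P.emb := by
  ext i j
  simp [unitMat, scalarMulMat, Matrix.mul_apply, P.emb_sum, P.emb_smul, P.emb_unit_mul]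

theorem PartialProduct.mul_unitMat {m n k : ℕ} (A : Matrix (Fin m) (Fin n) V)
    (β : Matrix (Fin n) (Fin k) ℂ) :
    A.map P.emb * (unitMat e β).map P.emb = (matMulScalar A β).map P.emb := by
  ext i j
  simp [unitMat, matMulScalar, Matrix.mul_apply, P.emb_sum, P.emb_smul, P.emb_mul_unit]

theorem scalarMulMat_smul_one {n k : ℕ} (c : ℂ) (A : Matrix (Fin n) (Fin k) V) :
    scalarMulMat (c • 1) A = c • A := by
  ext i j
  simp [scalarMulMat, Matrix.one_apply]

/-- The homomorphism out of `F_m(V)` induced by a linear map that respects `m`. -/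
def PartialProduct.lift {B : Type*} [Ring B] [Algebra ℂ B] (f : V →ₗ[ℂ] B)
    (hf : ∀ a b : V, (a, b) ∈ P.D → f (P.m a b) = f a * f b) : P.FreeAlg →ₐ[ℂ] B :=
  RingQuot.liftAlgHom ℂ ⟨TensorAlgebra.lift ℂ f, by
    rintro _ _ ⟨a, b, h, rfl, rfl⟩
    simp [hf a b h]⟩

theorem PartialProduct.lift_emb {B : Type*} [Ring B] [Algebra ℂ B] (f : V →ₗ[ℂ] B)
    (hf : ∀ a b : V, (a, b) ∈ P.D → f (P.m a b) = f a * f b) (x : V) :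
    P.lift f hf (P.emb x) = f x := by
  simp [PartialProduct.lift, PartialProduct.emb, RingQuot.liftAlgHom_mkAlgHom_apply]

end PartialProduct

section Factorizations

variable {E : Type} [NormedAddCommGroup E] [InnerProductSpace ℂ E]
  {X : Submodule ℂ (E →L[ℂ] E)} {e : ↥X}

theorem subMatNorm_nonneg {ι κ : Type} [Fintype ι] [Fintype κ] (A : Matrix ι κ ↥X) :
    0 ≤ subMatNorm A := opMatNorm_nonneg _

theorem subMatNorm_smul_le {ι κ : Type} [Fintype ι] [Fintype κ] (c : ℂ) (A : Matrix ι κ ↥X) :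
    subMatNorm (c • A) ≤ ‖c‖ * subMatNorm A :=
  opMatNorm_smul_le c (A.map fun v => (v : E →L[ℂ] E))

theorem subMatNorm_unitMat_le (he : ‖(e : E →L[ℂ] E)‖ = 1) {m n : ℕ}
    (α : Matrix (Fin m) (Fin n) ℂ) : subMatNorm (unitMat e α) ≤ cOpNorm α := by
  refine opMatNorm_le_of_sum_sq_le (cOpNorm_nonneg α) fun x => ?_
  refine (cOpNorm_sum_smul_sq_le α fun j => (e : E →L[ℂ] E) (x j)).trans ?_
  refine mul_le_mul_of_nonneg_left (Finset.sum_le_sum fun j _ => ?_) (sq_nonneg _)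
  have := (e : E →L[ℂ] E).le_opNorm (x j)
  rw [he, one_mul] at this
  exact pow_le_pow_left₀ (norm_nonneg _) this 2

theorem subMatNorm_unitMat_smul_one_le (he : ‖(e : E →L[ℂ] E)‖ = 1) (n : ℕ) (c : ℂ) :
    subMatNorm (unitMat e (c • (1 : Matrix (Fin n) (Fin n) ℂ))) ≤ ‖c‖ := by
  refine (subMatNorm_unitMat_le he _).trans (cOpNorm_le_of_sum_sq_le (norm_nonneg c) fun x => ?_)
  simp [Matrix.one_apply, mul_pow, Finset.mul_sum]

/-- `IsFactorization P N M r`: the matrix `M` over `F_m(X)` is a product of `N` matrices over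
`X` the product of whose norms is `r`. -/
inductive IsFactorization (P : PartialProduct ↥X e) :
    ℕ → {n k : ℕ} → Matrix (Fin n) (Fin k) P.FreeAlg → ℝ → Prop
  | nil (n : ℕ) : IsFactorization P 0 (1 : Matrix (Fin n) (Fin n) P.FreeAlg) 1
  | cons {N n l k : ℕ} {r : ℝ} (A : Matrix (Fin n) (Fin l) ↥X)
      {M : Matrix (Fin l) (Fin k) P.FreeAlg} (h : IsFactorization P N M r) :
      IsFactorization P (N + 1) (A.map P.emb * M) (subMatNorm A * r)

/-- `IsContractiveProduct P N M`: the matrix `M` over `F_m(X)` is a product of `N` contractive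
matrices over `X`. -/
inductive IsContractiveProduct (P : PartialProduct ↥X e) :
    ℕ → {n k : ℕ} → Matrix (Fin n) (Fin k) P.FreeAlg → Prop
  | nil (n : ℕ) : IsContractiveProduct P 0 (1 : Matrix (Fin n) (Fin n) P.FreeAlg)
  | cons {N n l k : ℕ} (A : Matrix (Fin n) (Fin l) ↥X) (hA : subMatNorm A ≤ 1)
      {M : Matrix (Fin l) (Fin k) P.FreeAlg} (h : IsContractiveProduct P N M) :
      IsContractiveProduct P (N + 1) (A.map P.emb * M)

variable {P : PartialProduct ↥X e}

theorem chainCost_cons {n l k : ℕ} (A : Matrix (Fin n) (Fin l) ↥X) (C : MatChain ↥X l k) :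
    chainCost (MatChain.cons A C) = subMatNorm A * chainCost C := by
  obtain ⟨len, dims, rfl, rfl, mats⟩ := C
  exact Fin.prod_univ_succ _

theorem MatChain.isFactorization (P : PartialProduct ↥X e) (N : ℕ) : ∀ {n k : ℕ}
    (C : MatChain ↥X n k), C.len = N → IsFactorization P N (C.prodIn P.emb) (chainCost C) := by
  induction N with
  | zero =>
    intro n k C hC
    obtain ⟨rfl, rfl⟩ := C.exists_eq_nil hC
    rw [MatChain.prodIn_nil]
    exact .nil n
  | succ N ih =>
    intro n k C hC
    obtain ⟨l, A, C', hC', rfl⟩ := C.exists_eq_cons hC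
    rw [MatChain.prodIn_cons, chainCost_cons]
    exact .cons A (ih C' hC')

theorem IsFactorization.exists_chain {N n k : ℕ} {M : Matrix (Fin n) (Fin k) P.FreeAlg} {r : ℝ}
    (h : IsFactorization P N M r) :
    ∃ C : MatChain ↥X n k, C.len = N ∧ C.prodIn P.emb = M ∧ r = chainCost C := by
  induction h with
  | nil n => exact ⟨.nil _ n, rfl, MatChain.prodIn_nil n _, rfl⟩
  | cons A h ih =>
    obtain ⟨C, rfl, rfl, rfl⟩ := ih
    exact ⟨.cons A C, rfl, MatChain.prodIn_cons A C _, (chainCost_cons A C).symm⟩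

theorem IsFactorization.nonneg {N n k : ℕ} {M : Matrix (Fin n) (Fin k) P.FreeAlg} {r : ℝ}
    (h : IsFactorization P N M r) : 0 ≤ r := by
  induction h with
  | nil => exact zero_le_one
  | cons A h ih => exact mul_nonneg (subMatNorm_nonneg A) ih

theorem IsFactorization.single {n k : ℕ} (A : Matrix (Fin n) (Fin k) ↥X) :
    IsFactorization P 1 (A.map P.emb) (subMatNorm A) := by
  simpa using IsFactorization.cons (P := P) A (.nil k)

theorem IsFactorization.snoc {N n k l : ℕ} {M : Matrix (Fin n) (Fin k) P.FreeAlg} {r : ℝ}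
    (h : IsFactorization P N M r) (B : Matrix (Fin k) (Fin l) ↥X) :
    IsFactorization P (N + 1) (M * B.map P.emb) (r * subMatNorm B) := by
  induction h with
  | nil n => simpa using IsFactorization.single (P := P) B
  | cons A h ih =>
    rw [Matrix.mul_assoc, mul_assoc]
    exact .cons A (ih B)

theorem IsFactorization.opMatNorm_map_le {K : Type} [NormedAddCommGroup K]
    [InnerProductSpace ℂ K] {π : P.FreeAlg →ₐ[ℂ] (K →L[ℂ] K)}
    (hπ : ∀ (n k : ℕ) (A : Matrix (Fin n) (Fin k) ↥X),
      opMatNorm (A.map fun x => π (P.emb x)) ≤ subMatNorm A)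
    {N n k : ℕ} {M : Matrix (Fin n) (Fin k) P.FreeAlg} {r : ℝ} (h : IsFactorization P N M r) :
    opMatNorm (M.map π) ≤ r := by
  induction h with
  | nil n =>
    rw [Matrix.map_one _ (map_zero π) (map_one π)]
    exact opMatNorm_one_le
  | cons A h ih =>
    rw [Matrix.map_mul]
    refine (opMatNorm_mul_le _ _).trans ?_
    rw [Matrix.map_map]
    exact mul_le_mul (hπ _ _ A) ih (opMatNorm_nonneg _) (subMatNorm_nonneg A)

theorem IsContractiveProduct.exists_isFactorization {N n k : ℕ}
    {M : Matrix (Fin n) (Fin k) P.FreeAlg} (h : IsContractiveProduct P N M) :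
    ∃ r ≤ 1, IsFactorization P N M r := by
  induction h with
  | nil n => exact ⟨1, le_rfl, .nil n⟩
  | cons A hA h ih =>
    obtain ⟨r, hr, hM⟩ := ih
    exact ⟨_, mul_le_one₀ hA hM.nonneg hr, .cons A hM⟩

theorem IsContractiveProduct.blockDiagSum {N n k : ℕ} {M : Matrix (Fin n) (Fin k) P.FreeAlg}
    (h : IsContractiveProduct P N M) :
    ∀ {p q : ℕ} {M' : Matrix (Fin p) (Fin q) P.FreeAlg}, IsContractiveProduct P N M' →
      IsContractiveProduct P N (blockDiagSum M M') := by
  induction h with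
  | nil n =>
    intro p q M' h'
    cases h'
    rw [blockDiagSum_one]
    exact .nil _
  | cons A hA h ih =>
    intro p q M' h'
    cases h' with
    | cons B hB h' =>
      rw [← blockDiagSum_mul, ← blockDiagSum_map _ P.emb_zero]
      refine .cons _ ?_ (ih h')
      rw [subMatNorm, blockDiagSum_map _ rfl]
      exact opMatNorm_blockDiagSum_le_one hA hB

/-- The cost of a factorization can be moved into a scalar, leaving contractive factors. -/
theorem IsFactorization.isContractiveProduct {N n k : ℕ}
    {M : Matrix (Fin n) (Fin k) P.FreeAlg} {r : ℝ} (h : IsFactorization P N M r) :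
    ∀ {p : ℕ} (Z : Matrix (Fin p) (Fin n) ↥X) {s : ℝ}, 0 < s → subMatNorm Z * r ≤ s →
      IsContractiveProduct P (N + 1) ((s : ℂ)⁻¹ • (Z.map P.emb * M)) := by
  have hsmul : ∀ {p q : ℕ} (Z : Matrix (Fin p) (Fin q) ↥X) (c : ℂ),
      c • Z.map P.emb = (c • Z).map P.emb := fun Z c => by
    ext i j
    simp [P.emb_smul]
  have hcontr : ∀ {p q : ℕ} (Z : Matrix (Fin p) (Fin q) ↥X) {s : ℝ}, 0 < s →
      subMatNorm Z ≤ s → subMatNorm ((s : ℂ)⁻¹ • Z) ≤ 1 := fun Z s hs hZ => by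
    refine (subMatNorm_smul_le _ Z).trans ?_
    rw [norm_inv, Complex.norm_real, Real.norm_of_nonneg hs.le]
    exact inv_mul_le_one_of_le₀ hZ hs.le
  induction h with
  | nil n =>
    intro p Z s hs hZ
    rw [mul_one] at hZ
    rw [← Matrix.smul_mul, hsmul]
    exact .cons _ (hcontr Z hs hZ) (.nil n)
  | @cons N n l k r A M h ih =>
    intro p Z s hs hZ
    obtain ⟨t, ht, hZt, hAt⟩ : ∃ t : ℝ, 0 < t ∧ subMatNorm Z ≤ t ∧
        subMatNorm A * r ≤ s / t := by
      have hr : 0 ≤ subMatNorm A * r := mul_nonneg (subMatNorm_nonneg A) h.nonneg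
      rcases (subMatNorm_nonneg Z).eq_or_lt with h0 | h0
      · refine ⟨s / (subMatNorm A * r + 1), by positivity, ?_, ?_⟩
        · rw [← h0]
          positivity
        · rw [div_div_cancel₀ hs.ne']
          linarith
      · refine ⟨subMatNorm Z, h0, le_rfl, ?_⟩
        rwa [le_div_iff₀' h0]
    have hscalar : (s : ℂ)⁻¹ = (t : ℂ)⁻¹ * ((s / t : ℝ) : ℂ)⁻¹ := by
      have : (t : ℂ) ≠ 0 := by exact_mod_cast ht.ne'
      have : (s : ℂ) ≠ 0 := by exact_mod_cast hs.ne'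
      push_cast
      field_simp
    rw [hscalar, mul_smul, ← Matrix.mul_smul, ← Matrix.smul_mul, hsmul]
    exact .cons _ (hcontr Z ht hZt) (ih A (div_pos hs ht) hAt)

theorem IsContractiveProduct.pad (he : ‖(e : E →L[ℂ] E)‖ = 1) {N n k : ℕ}
    {A : Matrix (Fin n) (Fin k) ↥X} (h : IsContractiveProduct P N (A.map P.emb)) (j : ℕ) :
    IsContractiveProduct P (N + j) (A.map P.emb) := by
  induction j with
  | zero => exact h
  | succ j ih =>
    have := IsContractiveProduct.cons (unitMat e ((1 : ℂ) • 1))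
      (by simpa using subMatNorm_unitMat_smul_one_le he n 1) ih
    rwa [P.unitMat_mul, scalarMulMat_smul_one, one_smul] at this

theorem IsFactorization.isContractiveProduct_map (he : ‖(e : E →L[ℂ] E)‖ = 1) {N n k : ℕ}
    {A : Matrix (Fin n) (Fin k) ↥X} {r s : ℝ} (h : IsFactorization P N (A.map P.emb) r)
    (hs : 0 < s) (hr : r ≤ s) :
    IsContractiveProduct P (N + 1) (((s : ℂ)⁻¹ • A).map P.emb) := by
  have := h.isContractiveProduct (unitMat e ((1 : ℂ) • 1)) hs
    ((mul_le_of_le_one_left h.nonneg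
      (by simpa using subMatNorm_unitMat_smul_one_le he n 1)).trans hr)
  rw [P.unitMat_mul, scalarMulMat_smul_one, one_smul] at this
  convert this using 1
  ext i j
  simp [P.emb_smul]

theorem factNorm_eq_sInf {n k : ℕ} (A : Matrix (Fin n) (Fin k) ↥X) :
    factNorm P A = sInf {r | ∃ N, 1 ≤ N ∧ IsFactorization P N (A.map P.emb) r} := by
  rw [factNorm]
  congr 1
  ext r
  constructor
  · rintro ⟨C, hlen, hC, rfl⟩
    exact ⟨C.len, hlen, hC ▸ C.isFactorization P _ rfl⟩
  · rintro ⟨N, hN, h⟩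
    obtain ⟨C, rfl, hC, hr⟩ := h.exists_chain
    exact ⟨C, hN, hC, hr⟩

theorem IsFactorization.factNorm_le {N n k : ℕ} {A : Matrix (Fin n) (Fin k) ↥X} {r : ℝ}
    (hN : 1 ≤ N) (h : IsFactorization P N (A.map P.emb) r) : factNorm P A ≤ r := by
  rw [factNorm_eq_sInf]
  exact csInf_le ⟨0, fun _ ⟨_, _, h⟩ => h.nonneg⟩ ⟨N, hN, h⟩

theorem le_factNorm {n k : ℕ} {A : Matrix (Fin n) (Fin k) ↥X} {c : ℝ}
    (h : ∀ N r, 1 ≤ N → IsFactorization P N (A.map P.emb) r → c ≤ r) : c ≤ factNorm P A := by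
  rw [factNorm_eq_sInf]
  exact le_csInf ⟨_, 1, le_rfl, .single A⟩ fun r ⟨N, hN, hr⟩ => h N r hN hr

theorem exists_isFactorization_of_factNorm_lt {n k : ℕ} {A : Matrix (Fin n) (Fin k) ↥X} {s : ℝ}
    (h : factNorm P A < s) : ∃ N r, IsFactorization P N (A.map P.emb) r ∧ r < s := by
  by_contra! hs
  exact h.not_ge (le_factNorm fun N r _ hr => hs N r hr)

theorem factNorm_nonneg {n k : ℕ} (A : Matrix (Fin n) (Fin k) ↥X) : 0 ≤ factNorm P A :=
  le_factNorm fun _ _ _ h => h.nonneg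

theorem factNorm_bimodule_le (he : ‖(e : E →L[ℂ] E)‖ = 1) {n m k l : ℕ}
    (A : Matrix (Fin n) (Fin m) ↥X) (α : Matrix (Fin k) (Fin n) ℂ)
    (β : Matrix (Fin m) (Fin l) ℂ) :
    factNorm P (matMulScalar (scalarMulMat α A) β) ≤
      cOpNorm α * cOpNorm β * factNorm P A := by
  have hle : ∀ N r, 1 ≤ N → IsFactorization P N (A.map P.emb) r →
      factNorm P (matMulScalar (scalarMulMat α A) β) ≤ cOpNorm α * cOpNorm β * r := by
    intro N r _ h
    have h' := (h.cons (unitMat e α)).snoc (unitMat e β)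
    rw [P.unitMat_mul, P.mul_unitMat] at h'
    refine (h'.factNorm_le (Nat.le_add_left 1 _)).trans ?_
    rw [mul_right_comm (cOpNorm α)]
    exact mul_le_mul (mul_le_mul_of_nonneg_right (subMatNorm_unitMat_le he α) h.nonneg)
      (subMatNorm_unitMat_le he β) (subMatNorm_nonneg _)
      (mul_nonneg (cOpNorm_nonneg α) h.nonneg)
  rcases (mul_nonneg (cOpNorm_nonneg α) (cOpNorm_nonneg β)).eq_or_lt with h0 | h0
  · simpa [← h0] using hle 1 _ le_rfl (.single A)
  · rw [← div_le_iff₀' h0]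
    exact le_factNorm fun N r hN hr => (div_le_iff₀' h0).2 (hle N r hN hr)

theorem factNorm_blockDiagSum_le (he : ‖(e : E →L[ℂ] E)‖ = 1) {n m p q : ℕ}
    (A : Matrix (Fin n) (Fin m) ↥X) (B : Matrix (Fin p) (Fin q) ↥X) :
    factNorm P (blockDiagSum A B) ≤ max (factNorm P A) (factNorm P B) := by
  refine le_of_forall_gt_imp_ge_of_dense fun s hs => ?_
  have hs0 : 0 < s := (factNorm_nonneg A).trans_lt ((le_max_left _ _).trans_lt hs)
  obtain ⟨N, r, hA, hr⟩ :=
    exists_isFactorization_of_factNorm_lt ((le_max_left _ _).trans_lt hs)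
  obtain ⟨N', r', hB, hr'⟩ :=
    exists_isFactorization_of_factNorm_lt ((le_max_right _ _).trans_lt hs)
  have hA' := (hA.isContractiveProduct_map he hs0 hr.le).pad he N'
  have hB' := (hB.isContractiveProduct_map he hs0 hr'.le).pad he N
  rw [show N' + 1 + N = N + 1 + N' by ring] at hB'
  obtain ⟨t, ht, hAB⟩ := (hA'.blockDiagSum hB').exists_isFactorization
  have h := hAB.cons (unitMat e ((s : ℂ) • (1 : Matrix (Fin (n + p)) (Fin (n + p)) ℂ)))
  have hsum : (s : ℂ) • blockDiagSum ((s : ℂ)⁻¹ • A) ((s : ℂ)⁻¹ • B) = blockDiagSum A B := by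
    have : (s : ℂ) ≠ 0 := by exact_mod_cast hs0.ne'
    rw [show blockDiagSum ((s : ℂ)⁻¹ • A) ((s : ℂ)⁻¹ • B) = _ from
      (blockDiagSum_map (fun x : ↥X => (s : ℂ)⁻¹ • x) (smul_zero _) A B).symm]
    ext1 i j
    exact smul_inv_smul₀ this _
  rw [← blockDiagSum_map _ P.emb_zero, P.unitMat_mul, scalarMulMat_smul_one, hsum] at h
  refine (h.factNorm_le (Nat.le_add_left 1 _)).trans ?_
  refine (mul_le_of_le_one_right (subMatNorm_nonneg _) ht).trans ?_
  simpa [abs_of_pos hs0] using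
    subMatNorm_unitMat_smul_one_le he (n + p) (s : ℂ)

theorem factNorm_blockDiagSum (he : ‖(e : E →L[ℂ] E)‖ = 1) {n k : ℕ}
    (A : Matrix (Fin n) (Fin n) ↥X) (B : Matrix (Fin k) (Fin k) ↥X) :
    factNorm P (blockDiagSum A B) = max (factNorm P A) (factNorm P B) := by
  refine (factNorm_blockDiagSum_le he A B).antisymm (max_le ?_ ?_)
  · have h := factNorm_bimodule_le (P := P) he (blockDiagSum A B) (leftProj n k)
      (leftProj n k).transpose
    rw [leftProj_compress_blockDiagSum] at h
    exact h.trans (mul_le_of_le_one_left (factNorm_nonneg _) (mul_le_one₀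
      (cOpNorm_leftProj_le n k) (cOpNorm_nonneg _) (cOpNorm_leftProj_transpose_le n k)))
  · have h := factNorm_bimodule_le (P := P) he (blockDiagSum A B) (rightProj n k)
      (rightProj n k).transpose
    rw [rightProj_compress_blockDiagSum] at h
    exact h.trans (mul_le_of_le_one_left (factNorm_nonneg _) (mul_le_one₀
      (cOpNorm_rightProj_le n k) (cOpNorm_nonneg _) (cOpNorm_rightProj_transpose_le n k)))

theorem opMatNorm_map_le_factNorm {K : Type} [NormedAddCommGroup K] [InnerProductSpace ℂ K]
    (i : ↥X →ₗ[ℂ] (K →L[ℂ] K))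
    (hi : ∀ (n k : ℕ) (A : Matrix (Fin n) (Fin k) ↥X), opMatNorm (A.map ⇑i) ≤ subMatNorm A)
    (hm : ∀ a b : ↥X, (a, b) ∈ P.D → i (P.m a b) = i a * i b) {n k : ℕ}
    (A : Matrix (Fin n) (Fin k) ↥X) : opMatNorm (A.map ⇑i) ≤ factNorm P A := by
  refine le_factNorm fun N r _ h => ?_
  have := h.opMatNorm_map_le (π := P.lift i hm) (by simpa only [P.lift_emb] using hi)
  simpa only [Matrix.map_map, Function.comp_def, P.lift_emb] using this

end Factorizations

/-- **The factorization quantity is an `L^∞`-matrix seminorm, and a norm in the presence of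
an injective completely contractive product representation.**  Let `X ⊆ B(H)` be a linear
subspace, `e ∈ X` with `‖e‖ = 1`, and `m` a non-degenerate partial product on `X`.  Then the
family `‖·‖^m` satisfies `‖α A β‖^m ≤ ‖α‖ ‖β‖ ‖A‖^m` and `‖A ⊕ B‖^m = max(‖A‖^m, ‖B‖^m)`.
Moreover, if there is an injective linear map `i : X → B(K)` with `i(e) = I` which is
completely contractive for the norms inherited from `B(H)` and multiplicative on the domain
of `m`, then each `‖·‖ₙ^m` is a norm and `‖i⁽ⁿ⁾(A)‖ ≤ ‖A‖ₙ^m` for all `A ∈ Mₙ(X)`. -/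
theorem factNorm_is_matrix_seminorm (X : Submodule ℂ (H →L[ℂ] H)) (e : ↥X)
    (he : ‖(e : H →L[ℂ] H)‖ = 1) (P : PartialProduct ↥X e)
    (hnd : Function.Injective P.emb) :
    (∀ (n k : ℕ) (A : Matrix (Fin n) (Fin n) ↥X)
        (α : Matrix (Fin k) (Fin n) ℂ) (β : Matrix (Fin n) (Fin k) ℂ),
        factNorm P (matMulScalar (scalarMulMat α A) β) ≤
          cOpNorm α * cOpNorm β * factNorm P A) ∧
    (∀ (n k : ℕ) (A : Matrix (Fin n) (Fin n) ↥X) (B : Matrix (Fin k) (Fin k) ↥X),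
        factNorm P (blockDiagSum A B) = max (factNorm P A) (factNorm P B)) ∧
    (∀ (K : Type) [instK : NormedAddCommGroup K] [instK2 : InnerProductSpace ℂ K]
        [instK3 : CompleteSpace K] (i : ↥X →ₗ[ℂ] (K →L[ℂ] K)),
        Function.Injective i →
        i e = 1 →
        (∀ (n k : ℕ) (A : Matrix (Fin n) (Fin k) ↥X),
          opMatNorm (A.map ⇑i) ≤ subMatNorm A) →
        (∀ a b : ↥X, (a, b) ∈ P.D → i (P.m a b) = i a * i b) →
        (∀ (n : ℕ) (A : Matrix (Fin n) (Fin n) ↥X), A ≠ 0 → 0 < factNorm P A) ∧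
        (∀ (n : ℕ) (A : Matrix (Fin n) (Fin n) ↥X), opMatNorm (A.map ⇑i) ≤ factNorm P A)) := by
  refine ⟨fun n k A α β => factNorm_bimodule_le he A α β,
    fun n k A B => factNorm_blockDiagSum he A B, ?_⟩
  intro K _ _ _ i hinj _ hi hm
  refine ⟨fun n A hA => (opMatNorm_pos fun h => hA ?_).trans_le
    (opMatNorm_map_le_factNorm i hi hm A), fun n A => opMatNorm_map_le_factNorm i hi hm A⟩
  ext1 a b
  exact hinj ((congrFun (congrFun h a) b).trans (map_zero i).symm)
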